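/- Let d ≥ 1, equip ℝ^d with Lebesgue measure, and let γ > 1 be a real number. Let f_n : ℝ^d → ℝ be a sequence of nonnegative measurable functions and f, g, h : ℝ^d → ℝ measurable functions such that f_n, f_n^γ, f_n^{γ+1}, f, g, h are all integrable on every closed ball, and such that for every closed ball B ⊆ ℝ^d one has ∫_B f_n → ∫_B f, ∫_B f_n^γ → ∫_B g, and ∫_B f_n^{γ+1} → ∫_B h as n → ∞. Then f(x)·g(x) ≤ h(x) for almost every x ∈ ℝ^d. -/

import Mathlib

open MeasureTheory Filter Topology

/-- **Chebyshev's integral inequality** for the powers `u` and `u ^ p` of a nonnegative function. -/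
theorem integral_mul_integral_rpow_le {α : Type*} [MeasurableSpace α] {μ : Measure α}
    [IsFiniteMeasure μ] {u : α → ℝ} {p : ℝ} (hp : 0 ≤ p) (hu : ∀ x, 0 ≤ u x)
    (hu1 : Integrable u μ) (hup : Integrable (fun x => u x ^ p) μ)
    (hup1 : Integrable (fun x => u x ^ (p + 1)) μ) :
    (∫ x, u x ∂μ) * ∫ x, u x ^ p ∂μ ≤ μ.real Set.univ * ∫ x, u x ^ (p + 1) ∂μ := by
  rcases eq_or_ne μ 0 with rfl | hμ
  · simp
  have hV : 0 < μ.real Set.univ := by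
    have : NeZero μ := ⟨hμ⟩
    exact measureReal_univ_pos
  set V := μ.real Set.univ
  set c := (∫ x, u x ∂μ) / V
  have hc : 0 ≤ c := div_nonneg (integral_nonneg hu) hV.le
  have key : 0 ≤ ∫ x, (u x ^ (p + 1) - c * u x ^ p - c ^ p * u x + c ^ p * c) ∂μ := by
    refine integral_nonneg fun x => ?_
    have hfac : u x ^ (p + 1) - c * u x ^ p - c ^ p * u x + c ^ p * c
        = (u x ^ p - c ^ p) * (u x - c) := by
      rw [Real.rpow_add_one' (hu x) (by positivity)]
      ring
    simp only [Pi.zero_apply, hfac]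
    rcases le_total (u x) c with hle | hle
    · exact mul_nonneg_of_nonpos_of_nonpos
        (sub_nonpos.2 (Real.rpow_le_rpow (hu x) hle hp)) (sub_nonpos.2 hle)
    · exact mul_nonneg (sub_nonneg.2 (Real.rpow_le_rpow hc hle hp)) (sub_nonneg.2 hle)
  rw [integral_add (by fun_prop) (by fun_prop), integral_sub (by fun_prop) (by fun_prop),
    integral_sub (by fun_prop) (by fun_prop), integral_const_mul, integral_const_mul,
    integral_const, smul_eq_mul] at key
  have hcV : V * c = ∫ x, u x ∂μ := mul_div_cancel₀ _ hV.ne'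
  rw [← hcV] at key ⊢
  nlinarith [mul_nonneg hV.le key]

/-- A function integrable on every closed ball is locally integrable. -/
theorem locallyIntegrable_of_integrableOn_closedBall {α E : Type*} [PseudoMetricSpace α]
    [MeasurableSpace α] [NormedAddCommGroup E] {μ : Measure α} {u : α → E}
    (hu : ∀ c r, IntegrableOn u (Metric.closedBall c r) μ) : LocallyIntegrable u μ :=
  fun x => ⟨Metric.closedBall x 1, Metric.closedBall_mem_nhds x one_pos, hu x 1⟩

theorem monotone_weak_limit_principle (d : ℕ) (hd : 1 ≤ d) (γ : ℝ) (hγ : 1 < γ)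
    (f : ℕ → EuclideanSpace ℝ (Fin d) → ℝ)
    (F g h : EuclideanSpace ℝ (Fin d) → ℝ)
    (hfm : ∀ n, Measurable (f n)) (hf0 : ∀ n x, 0 ≤ f n x)
    (hFm : Measurable F) (hgm : Measurable g) (hhm : Measurable h)
    (hfint : ∀ n c r, IntegrableOn (f n) (Metric.closedBall c r) volume)
    (hfγint : ∀ n c r, IntegrableOn (fun x => f n x ^ γ) (Metric.closedBall c r) volume)
    (hfγ1int : ∀ n c r, IntegrableOn (fun x => f n x ^ (γ + 1)) (Metric.closedBall c r) volume)
    (hFint : ∀ c r, IntegrableOn F (Metric.closedBall c r) volume)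
    (hgint : ∀ c r, IntegrableOn g (Metric.closedBall c r) volume)
    (hhint : ∀ c r, IntegrableOn h (Metric.closedBall c r) volume)
    (h1 : ∀ c r, Tendsto (fun n => ∫ x in Metric.closedBall c r, f n x) atTop
      (𝓝 (∫ x in Metric.closedBall c r, F x)))
    (h2 : ∀ c r, Tendsto (fun n => ∫ x in Metric.closedBall c r, f n x ^ γ) atTop
      (𝓝 (∫ x in Metric.closedBall c r, g x)))
    (h3 : ∀ c r, Tendsto (fun n => ∫ x in Metric.closedBall c r, f n x ^ (γ + 1)) atTop
      (𝓝 (∫ x in Metric.closedBall c r, h x))) :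
    ∀ᵐ x ∂(volume : Measure (EuclideanSpace ℝ (Fin d))), F x * g x ≤ h x := by
  have hball : ∀ c r, (∫ x in Metric.closedBall c r, F x) * (∫ x in Metric.closedBall c r, g x) ≤
      volume.real (Metric.closedBall c r) * ∫ x in Metric.closedBall c r, h x := by
    intro c r
    refine le_of_tendsto_of_tendsto' ((h1 c r).mul (h2 c r)) ((h3 c r).const_mul _) fun n => ?_
    have : IsFiniteMeasure (volume.restrict (Metric.closedBall c r)) :=
      ⟨by simpa using measure_closedBall_lt_top⟩
    simpa using integral_mul_integral_rpow_le (by linarith) (hf0 n) (hfint n c r) (hfγint n c r)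
      (hfγ1int n c r)
  have hlebesgue {u : EuclideanSpace ℝ (Fin d) → ℝ}
      (hu : ∀ c r, IntegrableOn u (Metric.closedBall c r) volume) :
      ∀ᵐ x, Tendsto (fun r => ⨍ y in Metric.closedBall x r, u y) (𝓝[>] 0) (𝓝 (u x)) := by
    filter_upwards [IsUnifLocDoublingMeasure.ae_tendsto_average volume
      (locallyIntegrable_of_integrableOn_closedBall hu) 1] with x hx
    refine hx (fun _ => x) id tendsto_id ?_
    filter_upwards [self_mem_nhdsWithin] with r hr
    simpa using (Set.mem_Ioi.1 hr).le
  filter_upwards [hlebesgue hFint, hlebesgue hgint, hlebesgue hhint] with x hF hg hh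
  refine le_of_tendsto_of_tendsto (hF.mul hg) hh ?_
  filter_upwards [self_mem_nhdsWithin] with r hr
  have hV : 0 < volume.real (Metric.closedBall x r) :=
    ENNReal.toReal_pos (Metric.measure_closedBall_pos volume x hr).ne'
      measure_closedBall_lt_top.ne
  simp only [setAverage_eq, smul_eq_mul]
  rw [mul_mul_mul_comm, mul_assoc]
  refine mul_le_mul_of_nonneg_left ?_ (inv_nonneg.2 hV.le)
  rw [inv_mul_le_iff₀ hV]
  exact hball x r
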